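/- Let d ≥ 5 and let F be a skew-symmetric endomorphism of Minkowski space 𝕄^{1,d-1}. Then F admits a spacelike eigenplane: there exist vectors u, v ∈ ℝ^d and μ ∈ ℝ with η(u,u) = 1, η(v,v) = 1, η(u,v) = 0, F u = μ v and F v = -μ u. -/

import Mathlib

open scoped BigOperators

/-- The Minkowski bilinear form on `ℝ^d`. -/
noncomputable def mink (d : ℕ) (x y : Fin d → ℝ) : ℝ :=
  ∑ i : Fin d, (if (i : ℕ) = 0 then (-1 : ℝ) else 1) * x i * y i

/-- Skew-symmetry w.r.t. the Minkowski form. -/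
def IsSkew (d : ℕ) (F : (Fin d → ℝ) →ₗ[ℝ] (Fin d → ℝ)) : Prop :=
  ∀ x y, mink d (F x) y = - mink d x (F y)

section MinkowskiForm

variable {d : ℕ}

lemma mink_comm (x y : Fin d → ℝ) : mink d x y = mink d y x := by
  unfold mink
  exact Finset.sum_congr rfl fun i _ => by ring

lemma mink_add_left (x y z : Fin d → ℝ) : mink d (x + y) z = mink d x z + mink d y z := by
  unfold mink
  rw [← Finset.sum_add_distrib]
  exact Finset.sum_congr rfl fun i _ => by simp only [Pi.add_apply]; ring

lemma mink_smul_left (a : ℝ) (x y : Fin d → ℝ) : mink d (a • x) y = a * mink d x y := by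
  unfold mink
  rw [Finset.mul_sum]
  exact Finset.sum_congr rfl fun i _ => by simp only [Pi.smul_apply, smul_eq_mul]; ring

lemma mink_add_right (x y z : Fin d → ℝ) : mink d x (y + z) = mink d x y + mink d x z := by
  rw [mink_comm, mink_add_left, mink_comm y, mink_comm z]

lemma mink_smul_right (a : ℝ) (x y : Fin d → ℝ) : mink d x (a • y) = a * mink d x y := by
  rw [mink_comm, mink_smul_left, mink_comm]

/-- The Minkowski pairing with a fixed vector, as a linear functional. -/
noncomputable def minkLeft (x : Fin d → ℝ) : (Fin d → ℝ) →ₗ[ℝ] ℝ where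
  toFun := mink d x
  map_add' := mink_add_right x
  map_smul' a y := mink_smul_right a x y

lemma mink_self_of_time_eq_zero [NeZero d] {x : Fin d → ℝ} (hx : x 0 = 0) :
    mink d x x = ∑ i, x i ^ 2 := by
  unfold mink
  refine Finset.sum_congr rfl fun i _ => ?_
  by_cases hi : (i : ℕ) = 0
  · obtain rfl : i = 0 := Fin.ext hi
    simp [hx]
  · simp only [hi, if_false]
    ring

/-- The Minkowski form is positive definite on the vectors without time component. -/
lemma mink_self_pos_of_time_eq_zero [NeZero d] {x : Fin d → ℝ} (hx : x 0 = 0) (hx' : x ≠ 0) :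
    0 < mink d x x := by
  rw [mink_self_of_time_eq_zero hx]
  obtain ⟨i, hi⟩ := Function.ne_iff.1 hx'
  exact Finset.sum_pos' (fun _ _ => sq_nonneg _) ⟨i, Finset.mem_univ i, by
    simp only [Pi.zero_apply] at hi
    positivity⟩

/-- Two orthogonal vectors neither of which is spacelike are linearly dependent. -/
lemma time_smul_eq_of_mink_nonpos [NeZero d] {x y : Fin d → ℝ} (hx : mink d x x ≤ 0)
    (hy : mink d y y ≤ 0) (hxy : mink d x y = 0) : y 0 • x = x 0 • y := by
  by_contra hne
  have hz : (y 0 • x + (-x 0) • y) ≠ 0 := by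
    rw [neg_smul, ← sub_eq_add_neg]
    exact sub_ne_zero.2 hne
  have hpos := mink_self_pos_of_time_eq_zero (x := y 0 • x + (-x 0) • y)
    (by simp; ring) hz
  simp only [mink_add_left, mink_add_right, mink_smul_left, mink_smul_right, mink_comm y x, hxy]
    at hpos
  nlinarith [mul_nonneg (sq_nonneg (y 0)) (neg_nonneg.2 hx),
    mul_nonneg (sq_nonneg (x 0)) (neg_nonneg.2 hy)]

/-- A nonzero vector that is not spacelike has a nonzero time component. -/
lemma time_ne_zero_of_mink_nonpos [NeZero d] {x : Fin d → ℝ} (hx : mink d x x ≤ 0)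
    (hx' : x ≠ 0) : x 0 ≠ 0 :=
  fun h => (mink_self_pos_of_time_eq_zero h hx').not_ge hx

/-- A null vector orthogonal to a nonzero null vector is proportional to it. -/
lemma mem_span_of_null_of_orthogonal [NeZero d] {n x : Fin d → ℝ} (hn : n ≠ 0)
    (hnn : mink d n n = 0) (hx : mink d x x = 0) (hnx : mink d n x = 0) :
    x ∈ Submodule.span ℝ {n} := by
  have h0 := time_ne_zero_of_mink_nonpos hnn.le hn
  refine Submodule.mem_span_singleton.2 ⟨(n 0)⁻¹ * x 0, ?_⟩
  rw [mul_smul, time_smul_eq_of_mink_nonpos hnn.le hx.le hnx, smul_smul, inv_mul_cancel₀ h0,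
    one_smul]

lemma exists_mink_normalized {x : Fin d → ℝ} (hx : 0 < mink d x x) :
    ∃ a : ℝ, mink d (a • x) (a • x) = 1 := by
  refine ⟨(√(mink d x x))⁻¹, ?_⟩
  rw [mink_smul_left, mink_smul_right, ← mul_assoc, ← mul_inv, Real.mul_self_sqrt hx.le,
    inv_mul_cancel₀ hx.ne']

end MinkowskiForm

/-- Fewer linear functionals than the dimension have a common nonzero zero. -/
lemma exists_ne_zero_forall_functional_eq_zero {d k : ℕ} (hk : k < d)
    (f : Fin k → (Fin d → ℝ) →ₗ[ℝ] ℝ) : ∃ x : Fin d → ℝ, x ≠ 0 ∧ ∀ i, f i x = 0 := by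
  have h : LinearMap.ker (LinearMap.pi f) ≠ ⊥ :=
    LinearMap.ker_ne_bot_of_finrank_lt (by simpa using hk)
  obtain ⟨x, hx, hx0⟩ := Submodule.exists_mem_ne_zero_of_ne_bot h
  exact ⟨x, hx0, fun i => congrFun (LinearMap.mem_ker.1 hx) i⟩

namespace IsSkew

variable {d : ℕ} {F : (Fin d → ℝ) →ₗ[ℝ] (Fin d → ℝ)}

lemma mink_apply_self (hF : IsSkew d F) (x : Fin d → ℝ) : mink d x (F x) = 0 := by
  have h := hF x x
  rw [mink_comm] at h
  linarith

/-- A vector annihilated by a quadratic polynomial without real roots yields a spacelike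
eigenplane. -/
lemma exists_eigenplane_of_quadratic [NeZero d] (hF : IsSkew d F) {x : Fin d → ℝ} (hx : x ≠ 0)
    {p r : ℝ} (hpr : p ^ 2 + 4 * r < 0) (h : F (F x) = p • F x + r • x) :
    ∃ (u v : Fin d → ℝ) (μ : ℝ),
      mink d u u = 1 ∧ mink d v v = 1 ∧ mink d u v = 0 ∧ F u = μ • v ∧ F v = (-μ) • u := by
  have hr : r < 0 := by nlinarith [sq_nonneg p]
  have h1 := hF.mink_apply_self x
  have h2 : mink d (F x) (F x) = -r * mink d x x := by
    rw [hF, h, mink_add_right, mink_smul_right, mink_smul_right, h1]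
    ring
  have h3 : p * mink d (F x) (F x) = 0 := by
    have := hF.mink_apply_self (F x)
    rwa [h, mink_add_right, mink_smul_right, mink_smul_right, mink_comm (F x) x, h1, mul_zero,
      add_zero] at this
  rcases lt_or_ge 0 (mink d x x) with hpos | hneg
  · have hp : p = 0 := by
      refine (mul_eq_zero.1 h3).resolve_right ?_
      rw [h2]
      exact (mul_pos (neg_pos.2 hr) hpos).ne'
    obtain ⟨a, ha1⟩ := exists_mink_normalized hpos
    obtain ⟨μ, hμ, rfl⟩ : ∃ μ : ℝ, μ ≠ 0 ∧ -(μ * μ) = r :=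
      ⟨√(-r), Real.sqrt_ne_zero'.2 (neg_pos.2 hr), by
        rw [Real.mul_self_sqrt (neg_pos.2 hr).le, neg_neg]⟩
    rw [mink_smul_left, mink_smul_right] at ha1
    refine ⟨a • x, μ⁻¹ • a • F x, μ, ?_, ?_, ?_, ?_, ?_⟩
    · rw [mink_smul_left, mink_smul_right, ha1]
    · simp only [mink_smul_left, mink_smul_right]
      rw [h2]
      field_simp
      linarith
    · simp only [mink_smul_left, mink_smul_right, h1, mul_zero]
    · rw [smul_smul, mul_inv_cancel₀ hμ, one_smul, map_smul]
    · rw [map_smul, map_smul, h, hp, zero_smul, zero_add, smul_smul, smul_smul, smul_smul]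
      congr 1
      field_simp
  · exfalso
    have hneg' : mink d (F x) (F x) ≤ 0 := by
      rw [h2]
      exact mul_nonpos_of_nonneg_of_nonpos (neg_pos.2 hr).le hneg
    have hx0 := time_ne_zero_of_mink_nonpos hneg hx
    have hdep := time_smul_eq_of_mink_nonpos hneg hneg' h1
    obtain ⟨t, ht⟩ : ∃ t : ℝ, F x = t • x :=
      ⟨(x 0)⁻¹ * F x 0, by
        rw [mul_smul, hdep, smul_smul, inv_mul_cancel₀ hx0, one_smul]⟩
    rw [ht, map_smul, ht] at h
    have h0 := congrFun h 0
    simp only [Pi.add_apply, Pi.smul_apply, smul_eq_mul] at h0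
    have hroot : t ^ 2 - p * t - r = 0 := by
      apply mul_right_cancel₀ hx0
      linear_combination h0
    nlinarith [sq_nonneg (2 * t - p)]

open Polynomial in
/-- If the minimal polynomial of a skew endomorphism does not split over the reals, then there is
a spacelike eigenplane. -/
lemma exists_eigenplane_of_not_splits [NeZero d] (hF : IsSkew d F) (h : ¬ (minpoly ℝ F).Splits) :
    ∃ (u v : Fin d → ℝ) (μ : ℝ),
      mink d u u = 1 ∧ mink d v v = 1 ∧ mink d u v = 0 ∧ F u = μ • v ∧ F v = (-μ) • u := by
  obtain ⟨z, hz, hzim⟩ : ∃ z : ℂ, aeval z (minpoly ℝ F) = 0 ∧ z.im ≠ 0 := by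
    by_contra! hcon
    refine h (Splits.of_splits_map (algebraMap ℝ ℂ) (IsAlgClosed.splits _) fun z hz => ?_)
    have hz0 : aeval z (minpoly ℝ F) = 0 := by
      simpa [aeval_def, eval_map] using (mem_roots'.1 hz).2
    exact ⟨z.re, Complex.ext rfl (hcon z hz0).symm⟩
  obtain ⟨g, hg⟩ := (minpoly ℝ F).quadratic_dvd_of_aeval_eq_zero_im_ne_zero hz hzim
  set q : ℝ[X] := X ^ 2 - C (2 * z.re) * X + C (‖z‖ ^ 2) with hq
  have hmonic := minpoly.monic (Algebra.IsIntegral.isIntegral (R := ℝ) F)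
  have hqdeg : q.natDegree = 2 := by rw [hq]; compute_degree!
  have hg0 : g ≠ 0 := by
    rintro rfl
    rw [mul_zero] at hg
    exact hmonic.ne_zero hg
  have hgF : aeval F g ≠ 0 := by
    intro hg'
    have hq0 : q ≠ 0 := by
      intro h0
      simp [h0] at hqdeg
    have h1 := natDegree_le_of_dvd (minpoly.dvd ℝ F hg') hg0
    rw [hg, natDegree_mul hq0 hg0] at h1
    omega
  obtain ⟨w, hw⟩ : ∃ w, aeval F g w ≠ 0 := by
    by_contra! hcon
    exact hgF (LinearMap.ext hcon)
  have hqx : aeval F q (aeval F g w) = 0 := by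
    rw [← Module.End.mul_apply, ← map_mul, ← hg, minpoly.aeval, LinearMap.zero_apply]
  refine hF.exists_eigenplane_of_quadratic hw (p := 2 * z.re) (r := -‖z‖ ^ 2) ?_ ?_
  · rw [Complex.sq_norm, Complex.normSq_apply]
    have : 0 < z.im ^ 2 := by positivity
    nlinarith
  · simp only [hq, map_add, map_sub, map_mul, aeval_X, aeval_C, LinearMap.add_apply,
      LinearMap.sub_apply, Module.End.mul_apply, pow_two, Module.algebraMap_end_apply] at hqx
    rw [pow_two, neg_smul, ← sub_eq_zero, ← hqx]
    simp only [mul_smul]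
    abel

/-- Let `U` be an invariant subspace and let `W` be an invariant subspace orthogonal to `U` which
contains every null vector of `U` that is an eigenvector modulo `W`. If a product of real linear
factors in `F` maps `x ∈ U` into `W`, then so does `F` itself. -/
lemma apply_mem_of_prod_mem (hF : IsSkew d F) {U W : Submodule ℝ (Fin d → ℝ)}
    (hU : ∀ x ∈ U, F x ∈ U) (hW : ∀ x ∈ W, F x ∈ W)
    (hWU : ∀ w ∈ W, ∀ x ∈ U, mink d w x = 0)
    (hnull : ∀ x ∈ U, ∀ a : ℝ, mink d x x = 0 → F x - a • x ∈ W → x ∈ W)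
    (s : Multiset ℝ) : ∀ x ∈ U,
      Polynomial.aeval F (s.map fun a => Polynomial.X - Polynomial.C a).prod x ∈ W → F x ∈ W := by
  induction s using Multiset.induction with
  | empty =>
    intro x _ hxW
    simp only [Multiset.map_zero, Multiset.prod_zero, map_one, Module.End.one_apply] at hxW
    exact hW x hxW
  | cons a t ih =>
    intro x hx hxW
    rw [Multiset.map_cons, Multiset.prod_cons, mul_comm, map_mul, Module.End.mul_apply] at hxW
    have hmem := ih _ (by simpa using U.sub_mem (hU x hx) (U.smul_mem a hx)) hxW
    simp only [map_sub, Polynomial.aeval_X, Polynomial.aeval_C, LinearMap.sub_apply,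
      Module.algebraMap_end_apply, map_smul] at hmem
    refine hnull _ (hU x hx) a ?_ hmem
    have h := hWU _ hmem x hx
    rw [sub_eq_add_neg, ← neg_smul, mink_add_left, mink_smul_left, mink_comm (F x) x,
      hF.mink_apply_self, hF] at h
    linarith

/-- If the minimal polynomial splits, then either `F = 0` or there is a null eigenvector whose
orthogonal complement is mapped into its span. -/
lemma exists_null_of_splits [NeZero d] (hF : IsSkew d F) (h : (minpoly ℝ F).Splits) :
    F = 0 ∨ ∃ n : Fin d → ℝ, n ≠ 0 ∧ mink d n n = 0 ∧
      ∀ x, mink d n x = 0 → F x ∈ Submodule.span ℝ {n} := by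
  obtain ⟨s, hs⟩ := Polynomial.splits_iff_exists_multiset.1 h
  rw [minpoly.monic (Algebra.IsIntegral.isIntegral (R := ℝ) F), Polynomial.C_1, one_mul] at hs
  have hzero := minpoly.aeval ℝ F
  rw [hs] at hzero
  by_cases hex : ∃ n : Fin d → ℝ, n ≠ 0 ∧ mink d n n = 0 ∧ ∃ a : ℝ, F n = a • n
  · obtain ⟨n, hn, hnn, a, ha⟩ := hex
    refine Or.inr ⟨n, hn, hnn, fun x hx => ?_⟩
    refine hF.apply_mem_of_prod_mem (U := LinearMap.ker (minkLeft n)) ?_ ?_ ?_ ?_ s x hx ?_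
    · intro y hy
      change mink d n (F y) = 0
      have h1 := hF n y
      rw [ha, mink_smul_left, show mink d n y = 0 from hy] at h1
      linarith
    · intro y hy
      obtain ⟨c, rfl⟩ := Submodule.mem_span_singleton.1 hy
      rw [map_smul, ha]
      exact Submodule.smul_mem _ _ (Submodule.smul_mem _ _ (Submodule.mem_span_singleton_self n))
    · intro w hw y hy
      obtain ⟨c, rfl⟩ := Submodule.mem_span_singleton.1 hw
      rw [mink_smul_left, show mink d n y = 0 from hy, mul_zero]
    · exact fun y hy _ hyy _ => mem_span_of_null_of_orthogonal hn hnn hyy hy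
    · rw [hzero]
      exact Submodule.zero_mem _
  · refine Or.inl (LinearMap.ext fun x => ?_)
    rw [LinearMap.zero_apply, ← Submodule.mem_bot ℝ]
    refine hF.apply_mem_of_prod_mem (U := ⊤) (fun _ _ => Submodule.mem_top) ?_ ?_ ?_ s x
      Submodule.mem_top (by rw [hzero]; exact Submodule.zero_mem _)
    · intro y hy
      rw [(Submodule.mem_bot ℝ).1 hy, map_zero]
      exact Submodule.zero_mem _
    · intro w hw y _
      rw [(Submodule.mem_bot ℝ).1 hw]
      exact (minkLeft y).map_zero ▸ mink_comm 0 y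
    · intro y _ a hyy hya
      rw [Submodule.mem_bot] at hya ⊢
      by_contra hy
      exact hex ⟨y, hy, hyy, a, sub_eq_zero.1 hya⟩

/-- A vector `n` such that `F x` vanishes as soon as `x` is orthogonal to `n` and `F x` has no time
component yields a spacelike plane in the kernel, in dimension at least five. -/
lemma exists_plane_in_ker [NeZero d] (hd : 5 ≤ d) {n : Fin d → ℝ}
    (hn : ∀ x, mink d n x = 0 → F x 0 = 0 → F x = 0) :
    ∃ u v : Fin d → ℝ, mink d u u = 1 ∧ mink d v v = 1 ∧ mink d u v = 0 ∧ F u = 0 ∧ F v = 0 := by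
  let time : (Fin d → ℝ) →ₗ[ℝ] ℝ := LinearMap.proj 0
  obtain ⟨u, hu, hu'⟩ := exists_ne_zero_forall_functional_eq_zero (show 3 < d by omega)
    ![time, minkLeft n, time ∘ₗ F]
  obtain ⟨v, hv, hv'⟩ := exists_ne_zero_forall_functional_eq_zero (show 4 < d by omega)
    ![time, minkLeft n, time ∘ₗ F, minkLeft u]
  obtain ⟨a, ha⟩ := exists_mink_normalized (mink_self_pos_of_time_eq_zero (hu' 0) hu)
  obtain ⟨b, hb⟩ := exists_mink_normalized (mink_self_pos_of_time_eq_zero (hv' 0) hv)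
  refine ⟨a • u, b • v, ha, hb, ?_, ?_, ?_⟩
  · rw [mink_smul_left, mink_smul_right, show mink d u v = 0 from hv' 3, mul_zero, mul_zero]
  · rw [map_smul, hn u (hu' 1) (hu' 2), smul_zero]
  · rw [map_smul, hn v (hv' 1) (hv' 2), smul_zero]

end IsSkew

/-- Every skew-symmetric endomorphism of `𝕄^{1,d-1}` with `d ≥ 5` admits a
spacelike eigenplane. -/
theorem stmt5 (d : ℕ) (hd : 5 ≤ d)
    (F : (Fin d → ℝ) →ₗ[ℝ] (Fin d → ℝ)) (hF : IsSkew d F) :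
    ∃ (u v : Fin d → ℝ) (μ : ℝ),
      mink d u u = 1 ∧ mink d v v = 1 ∧ mink d u v = 0 ∧
      F u = μ • v ∧ F v = (-μ) • u := by
  have : NeZero d := ⟨by omega⟩
  by_cases hsplit : (minpoly ℝ F).Splits
  · obtain ⟨n, hn⟩ : ∃ n : Fin d → ℝ, ∀ x, mink d n x = 0 → F x 0 = 0 → F x = 0 := by
      rcases hF.exists_null_of_splits hsplit with rfl | ⟨n, hn, hnn, hspan⟩
      · exact ⟨0, fun _ _ _ => rfl⟩
      · refine ⟨n, fun x hx h0 => ?_⟩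
        obtain ⟨c, hc⟩ := Submodule.mem_span_singleton.1 (hspan x hx)
        rw [← hc, Pi.smul_apply, smul_eq_mul] at h0
        rw [← hc, (mul_eq_zero.1 h0).resolve_right (time_ne_zero_of_mink_nonpos hnn.le hn),
          zero_smul]
    obtain ⟨u, v, hu, hv, huv, hFu, hFv⟩ := IsSkew.exists_plane_in_ker hd hn
    exact ⟨u, v, 0, hu, hv, huv, by rw [hFu, zero_smul], by rw [hFv, neg_zero, zero_smul]⟩
  · exact hF.exists_eigenplane_of_not_splits hsplit
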